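/- arXiv:1401.4907 — 5 statements merged into one kernel-verified Lean document; each statement's English description precedes it below -/
import Mathlib

section
/- Fix R > 0, α > 1, T > 1, and let Θ₁ = (α, ρ_{r1}, ρ_{d1}, ρ_{s1}, ρ_{01}, T) and Θ₂ = (α, ρ_{r2}, ρ_{d2}, ρ_{s2}, ρ_{02}, T) be parameter tuples with ρ_{r2} ≥ ρ_{r1}, ρ_{d2} ≥ ρ_{d1}, ρ_{s2} ≥ ρ_{s1}, ρ_{02} ≥ ρ_{01}, at least one of these inequalities being strict. Then ζ*_zf(R,Θ₁) > ζ*_zf(R,Θ₂). -/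
open Real

/-- Uplink SINR-like quantity γ_u(M,K,τ,R,T). -/
noncomputable def gammaU (M K τ R T : ℝ) : ℝ :=
  ((K + τ) * ((2:ℝ) ^ (R / (K * (1 - τ / T))) - 1)) / (2 * τ * (M - K)) +
    Real.sqrt ((((K + τ) * ((2:ℝ) ^ (R / (K * (1 - τ / T))) - 1)) / (2 * τ * (M - K))) ^ 2 +
      ((2:ℝ) ^ (R / (K * (1 - τ / T))) - 1) / (τ * (M - K)))

/-- Total normalized power consumption P(M,K,τ,R,Θ). -/
noncomputable def Ptot (M K τ R α ρr ρd ρs ρ0 T : ℝ) : ℝ :=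
  α * K * gammaU M K τ R T + ρs + K * (ρd + (8/3) * K ^ 2 * ρ0 / T) +
    M * (ρr + 2 * K * ρ0 + 4 * K ^ 2 * ρ0 / T)

/-- Optimal normalized energy efficiency ζ*_zf(R,Θ) (integer optimization). -/
noncomputable def zetaZfStar (R α ρr ρd ρs ρ0 T : ℝ) : ℝ :=
  R / sInf {p : ℝ | ∃ M K τ : ℤ, 1 ≤ K ∧ K ≤ τ ∧ (τ : ℝ) < T ∧ K < M ∧
    p = Ptot (M : ℝ) (K : ℝ) (τ : ℝ) R α ρr ρd ρs ρ0 T}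

/-- Maximum number of users K_max(Θ). -/
noncomputable def Kmax (ρr ρd ρ0 T : ℝ) : ℝ :=
  min (T / 4) (min (ρr / (3 * ρ0)) (3 * ρd / (2 * ρ0)))

/-- The function g(x). -/
noncomputable def gfun (x : ℝ) : ℝ :=
  Real.sqrt (x / ((2:ℝ) ^ x - 1)) * ((2:ℝ) ^ x * x * Real.log 2 - (2:ℝ) ^ x + 1)

/-- Ideal (perfect CSI) power consumption P_csi(M,K,R,Θ). -/
noncomputable def Pcsi (M K R α ρr ρd ρs : ℝ) : ℝ :=
  α * K * ((2:ℝ) ^ (R / K) - 1) / (M - K) + M * ρr + K * ρd + ρs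

/-- Relaxed (real-valued) optimal EE ζ'_zf(R,Θ) with K ≤ K_max(Θ). -/
noncomputable def zetaZfPrime (R α ρr ρd ρs ρ0 T : ℝ) : ℝ :=
  R / sInf {p : ℝ | ∃ M K τ : ℝ, 1 ≤ K ∧ K ≤ Kmax ρr ρd ρ0 T ∧ K ≤ τ ∧ τ < T ∧ K < M ∧
    p = Ptot M K τ R α ρr ρd ρs ρ0 T}

/-- Optimal EE of the ideal perfect-CSI system ζ'_csi(R,Θ). -/
noncomputable def zetaCsiPrime (R α ρr ρd ρs ρ0 T : ℝ) : ℝ :=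
  R / sInf {p : ℝ | ∃ M K : ℝ, 1 ≤ K ∧ K ≤ Kmax ρr ρd ρ0 T ∧ K < M ∧
    p = Pcsi M K R α ρr ρd ρs}

/-- Relaxed optimal EE with the number of users fixed to K. -/
noncomputable def zetaZfFixedK (K R α ρr ρd ρs ρ0 T : ℝ) : ℝ :=
  R / sInf {p : ℝ | ∃ M τ : ℝ, K < M ∧ K ≤ τ ∧ τ < T ∧
    p = Ptot M K τ R α ρr ρd ρs ρ0 T}

/-- On the feasible region, `γ_u` is nonnegative. -/
lemma gammaU_nonneg {M K τ R T : ℝ} (hR : 0 ≤ R) (hK : 0 ≤ K) (hτ : 0 ≤ τ) (hτT : τ < T)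
    (hM : K ≤ M) : 0 ≤ gammaU M K τ R T := by
  have hT : 0 < T := hτ.trans_lt hτT
  have hfrac : 0 ≤ 1 - τ / T := sub_nonneg.2 ((div_le_one hT).2 hτT.le)
  have hE : 0 ≤ (2 : ℝ) ^ (R / (K * (1 - τ / T))) - 1 :=
    sub_nonneg.2 (Real.one_le_rpow (by norm_num) (by positivity))
  have hMK : 0 ≤ M - K := sub_nonneg.2 hM
  unfold gammaU
  positivity

/-- The power consumption is bounded below by its static part. -/
lemma le_Ptot {M K τ R α ρr ρd ρs ρ0 T : ℝ} (hR : 0 ≤ R) (hα : 0 ≤ α) (hr : 0 ≤ ρr)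
    (hd : 0 ≤ ρd) (h0 : 0 ≤ ρ0) (hK : 0 ≤ K) (hτ : 0 ≤ τ) (hτT : τ < T) (hM : K ≤ M) :
    ρs ≤ Ptot M K τ R α ρr ρd ρs ρ0 T := by
  have hT : 0 < T := hτ.trans_lt hτT
  have hM0 : 0 ≤ M := hK.trans hM
  have hγ : 0 ≤ α * K * gammaU M K τ R T :=
    mul_nonneg (mul_nonneg hα hK) (gammaU_nonneg hR hK hτ hτT hM)
  have hKd : 0 ≤ K * (ρd + (8 / 3) * K ^ 2 * ρ0 / T) := by positivity
  have hMr : 0 ≤ M * (ρr + 2 * K * ρ0 + 4 * K ^ 2 * ρ0 / T) := by positivity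
  unfold Ptot
  linarith

/-- The power consumption grows at least by the sum of the increments of its parameters,
uniformly in the operating point. -/
lemma Ptot_add_le {M K τ R α ρr₁ ρd₁ ρs₁ ρ0₁ ρr₂ ρd₂ ρs₂ ρ0₂ T : ℝ} (hT : 0 < T)
    (hK : 1 ≤ K) (hM : 1 ≤ M) (hr : ρr₁ ≤ ρr₂) (hd : ρd₁ ≤ ρd₂) (h0 : ρ0₁ ≤ ρ0₂) :
    Ptot M K τ R α ρr₁ ρd₁ ρs₁ ρ0₁ T +
        ((ρr₂ - ρr₁) + (ρd₂ - ρd₁) + (ρs₂ - ρs₁) + (ρ0₂ - ρ0₁)) ≤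
      Ptot M K τ R α ρr₂ ρd₂ ρs₂ ρ0₂ T := by
  have hdiff : Ptot M K τ R α ρr₂ ρd₂ ρs₂ ρ0₂ T - Ptot M K τ R α ρr₁ ρd₁ ρs₁ ρ0₁ T =
      (ρs₂ - ρs₁) + K * (ρd₂ - ρd₁) + M * (ρr₂ - ρr₁) + 2 * (M * K) * (ρ0₂ - ρ0₁) +
        ((8 / 3) * K ^ 3 + 4 * M * K ^ 2) / T * (ρ0₂ - ρ0₁) := by
    unfold Ptot
    ring
  have hrest : 0 ≤ ((8 / 3) * K ^ 3 + 4 * M * K ^ 2) / T * (ρ0₂ - ρ0₁) :=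
    mul_nonneg (by positivity) (sub_nonneg.2 h0)
  have hKd := le_mul_of_one_le_left (sub_nonneg.2 hd) hK
  have hMr := le_mul_of_one_le_left (sub_nonneg.2 hr) hM
  have hMK : 1 ≤ M * K := one_le_mul_of_one_le_of_one_le hM hK
  have hMK0 := le_mul_of_one_le_left (sub_nonneg.2 h0) (by linarith : 1 ≤ 2 * (M * K))
  linarith

/-- ζ*_zf strictly decreases when the PCPs increase (Theorem 1). -/
theorem stmt_1 (R α T ρr₁ ρd₁ ρs₁ ρ0₁ ρr₂ ρd₂ ρs₂ ρ0₂ : ℝ)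
    (hR : 0 < R) (hα : 1 < α) (hT : 1 < T)
    (hρr₁ : 0 < ρr₁) (hρd₁ : 0 < ρd₁) (hρs₁ : 0 < ρs₁) (hρ0₁ : 0 < ρ0₁)
    (hρr₂ : 0 < ρr₂) (hρd₂ : 0 < ρd₂) (hρs₂ : 0 < ρs₂) (hρ0₂ : 0 < ρ0₂)
    (hr : ρr₁ ≤ ρr₂) (hd : ρd₁ ≤ ρd₂) (hs : ρs₁ ≤ ρs₂) (h0 : ρ0₁ ≤ ρ0₂)
    (hstrict : ρr₁ < ρr₂ ∨ ρd₁ < ρd₂ ∨ ρs₁ < ρs₂ ∨ ρ0₁ < ρ0₂) :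
    zetaZfStar R α ρr₂ ρd₂ ρs₂ ρ0₂ T < zetaZfStar R α ρr₁ ρd₁ ρs₁ ρ0₁ T := by
  have hlower : ∀ p ∈ {p : ℝ | ∃ M K τ : ℤ, 1 ≤ K ∧ K ≤ τ ∧ (τ : ℝ) < T ∧ K < M ∧
      p = Ptot (M : ℝ) (K : ℝ) (τ : ℝ) R α ρr₁ ρd₁ ρs₁ ρ0₁ T}, ρs₁ ≤ p := by
    rintro p ⟨M, K, τ, hK, hτ, hτT, hM, rfl⟩
    exact le_Ptot hR.le (by linarith) hρr₁.le hρd₁.le hρ0₁.le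
      (by exact_mod_cast (by lia : 0 ≤ K)) (by exact_mod_cast (by lia : 0 ≤ τ)) hτT
      (by exact_mod_cast hM.le)
  have hT1 : ((1 : ℤ) : ℝ) < T := by exact_mod_cast hT
  have hpos : 0 < sInf {p : ℝ | ∃ M K τ : ℤ, 1 ≤ K ∧ K ≤ τ ∧ (τ : ℝ) < T ∧ K < M ∧
      p = Ptot (M : ℝ) (K : ℝ) (τ : ℝ) R α ρr₁ ρd₁ ρs₁ ρ0₁ T} :=
    hρs₁.trans_le (le_csInf ⟨_, 2, 1, 1, le_rfl, le_rfl, hT1, by norm_num, rfl⟩ hlower)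
  refine div_lt_div_of_pos_left hR hpos ?_
  have hδ : 0 < (ρr₂ - ρr₁) + (ρd₂ - ρd₁) + (ρs₂ - ρs₁) + (ρ0₂ - ρ0₁) := by
    rcases hstrict with h | h | h | h <;> linarith
  refine (lt_add_of_pos_right _ hδ).trans_le
    (le_csInf ⟨_, 2, 1, 1, le_rfl, le_rfl, hT1, by norm_num, rfl⟩ ?_)
  rintro p ⟨M, K, τ, hK, hτ, hτT, hM, rfl⟩
  have hinf := csInf_le ⟨ρs₁, hlower⟩ ⟨M, K, τ, hK, hτ, hτT, hM, rfl⟩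
  exact (add_le_add_left hinf _).trans (Ptot_add_le (by linarith) (by exact_mod_cast hK)
    (by exact_mod_cast (by lia : 1 ≤ M)) hr hd h0)
end

section
/- Let Θ = (α, ρ_r, ρ_d, ρ_s, ρ_0, T) be a parameter tuple with β := ρ_d/ρ_r satisfying min(T/4, 1/(3·ρ_0/ρ_r), 3β/(2·ρ_0/ρ_r)) > 10. Then there exists a unique c(Θ) > 0 with g(c(Θ))/sqrt(c(Θ)) = (1 + β)·sqrt(K_max(Θ)·ρ_r/α), and with R_max(Θ) := c(Θ)·K_max(Θ), for every R > 0 the inequality ρ_r > (3α/(4(1+β)²·R))·g(4R/(3·K_max(Θ)))² holds if and only if R < (3/4)·R_max(Θ). -/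
open Real

/-- The function `gfun x / √x` expressed in the variable `t = 2 ^ x`. -/
noncomputable def gRatio (t : ℝ) : ℝ := (t * log t - t + 1) / √(t - 1)

lemma gRatio_eq_mul {t : ℝ} (ht : 1 < t) :
    gRatio t = √(t - 1) * ((t * log t - 1 * log 1) / (t - 1) - 1) := by
  have h1 : 0 < t - 1 := by linarith
  have h2 : 0 < √(t - 1) := Real.sqrt_pos.2 h1
  have h3 : √(t - 1) ^ 2 = t - 1 := Real.sq_sqrt h1.le
  rw [gRatio, div_eq_iff h2.ne', Real.log_one]
  have : √(t - 1) * ((t * log t - 1 * 0) / (t - 1) - 1) * √(t - 1) =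
      √(t - 1) ^ 2 * ((t * log t - 1 * 0) / (t - 1) - 1) := by ring
  rw [this, h3]
  field_simp
  ring

lemma one_lt_slope_mul_log {t : ℝ} (ht : 1 < t) :
    1 < (t * log t - 1 * log 1) / (t - 1) := by
  have h0 : 0 < t := by linarith
  rw [lt_div_iff₀ (by linarith), Real.log_one]
  have h := Real.log_lt_sub_one_of_pos (inv_pos.2 h0) (inv_lt_one_of_one_lt₀ ht).ne
  rw [Real.log_inv] at h
  have h2 := mul_lt_mul_of_pos_left h h0
  have h3 : t * (t⁻¹ - 1) = 1 - t := by field_simp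
  linarith

lemma gRatio_pos {t : ℝ} (ht : 1 < t) : 0 < gRatio t := by
  rw [gRatio_eq_mul ht]
  exact mul_pos (Real.sqrt_pos.2 (by linarith)) (by linarith [one_lt_slope_mul_log ht])

lemma strictMonoOn_gRatio : StrictMonoOn gRatio (Set.Ioi 1) := by
  intro a ha b hb hab
  have ha : 1 < a := ha
  have hb : 1 < b := hb
  rw [gRatio_eq_mul ha, gRatio_eq_mul hb]
  have hs := Real.strictConvexOn_mul_log.secant_strict_mono (a := 1) (x := a) (y := b)
    (by simp) (by simp; linarith) (by simp; linarith) ha.ne' hb.ne' hab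
  refine mul_lt_mul'' (Real.sqrt_lt_sqrt (by linarith) (by linarith)) (by linarith)
    (Real.sqrt_nonneg _) (by linarith [one_lt_slope_mul_log ha])

lemma exists_gRatio_eq {v : ℝ} (hv : 0 < v) : ∃ t, 1 < t ∧ gRatio t = v := by
  set s := min 1 (v ^ 2) with hs
  have hs0 : 0 < s := lt_min one_pos (by positivity)
  have hs1 : s ≤ 1 := min_le_left _ _
  have hs2 : √s ≤ v := Real.sqrt_le_iff.2 ⟨hv.le, min_le_right _ _⟩
  have he := Real.exp_pos 2
  have hlow : gRatio (1 + s) ≤ v := by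
    have h0 : 0 < √s := Real.sqrt_pos.2 hs0
    rw [gRatio, add_sub_cancel_left, div_le_iff₀ h0]
    have hl := mul_le_mul_of_nonneg_left (Real.log_le_sub_one_of_pos (x := 1 + s) (by linarith))
      (by linarith : 0 ≤ 1 + s)
    have h1 : s ≤ v * √s := by
      nlinarith [Real.mul_self_sqrt hs0.le]
    nlinarith
  set b := Real.exp 2 + 1 + v ^ 2 with hb
  have hb1 : 1 < b := by nlinarith [sq_nonneg v]
  have hhigh : v ≤ gRatio b := by
    have hlog : 2 ≤ log b := (Real.le_log_iff_exp_le (by linarith)).2 (by nlinarith [sq_nonneg v])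
    have hvb : v ≤ √(b - 1) := Real.le_sqrt_of_sq_le (by linarith)
    have h0 : 0 < √(b - 1) := Real.sqrt_pos.2 (by linarith)
    rw [gRatio, le_div_iff₀ h0]
    have h1 : v * √(b - 1) ≤ b - 1 := by
      nlinarith [Real.mul_self_sqrt (by linarith : 0 ≤ b - 1)]
    nlinarith
  have hle : 1 + s ≤ b := by
    have : s ≤ v ^ 2 := min_le_right _ _
    linarith
  have hcont : ContinuousOn gRatio (Set.Icc (1 + s) b) := by
    unfold gRatio
    refine ContinuousOn.div ?_ (by fun_prop) ?_
    · exact (Real.continuous_mul_log.sub continuous_id).add continuous_const |>.continuousOn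
    · intro t ht
      exact (Real.sqrt_pos.2 (by linarith [ht.1])).ne'
  obtain ⟨t, ht, rfl⟩ := intermediate_value_Icc hle hcont ⟨hlow, hhigh⟩
  exact ⟨t, by linarith [ht.1], rfl⟩

lemma one_lt_two_rpow {x : ℝ} (hx : 0 < x) : (1 : ℝ) < 2 ^ x :=
  Real.one_lt_rpow one_lt_two hx

lemma gfun_div_sqrt {x : ℝ} (hx : 0 < x) : gfun x / √x = gRatio (2 ^ x) := by
  have h0 : 0 < √x := Real.sqrt_pos.2 hx
  have h1 : 0 < √((2 : ℝ) ^ x - 1) := Real.sqrt_pos.2 (by linarith [one_lt_two_rpow hx])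
  rw [gfun, gRatio, Real.sqrt_div hx.le, Real.log_rpow two_pos]
  field_simp

lemma gRatio_two_rpow_lt_iff {x y : ℝ} (hx : 0 < x) (hy : 0 < y) :
    gRatio (2 ^ x) < gRatio (2 ^ y) ↔ x < y := by
  rw [strictMonoOn_gRatio.lt_iff_lt (one_lt_two_rpow hx) (one_lt_two_rpow hy),
    Real.rpow_lt_rpow_left_iff one_lt_two]

lemma existsUnique_gfun_div_sqrt_eq {v : ℝ} (hv : 0 < v) :
    ∃! c : ℝ, 0 < c ∧ gfun c / √c = v := by
  obtain ⟨t, ht, rfl⟩ := exists_gRatio_eq hv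
  have hc : 0 < Real.logb 2 t := Real.logb_pos one_lt_two ht
  have hpow : (2 : ℝ) ^ Real.logb 2 t = t :=
    Real.rpow_logb two_pos (by norm_num) (by linarith)
  have hval : gfun (Real.logb 2 t) / √(Real.logb 2 t) = gRatio t := by
    rw [gfun_div_sqrt hc, hpow]
  refine ⟨_, ⟨hc, hval⟩, ?_⟩
  rintro d ⟨hd, hdv⟩
  rw [← hval, gfun_div_sqrt hd, gfun_div_sqrt hc] at hdv
  refine le_antisymm (not_lt.1 fun h => ?_) (not_lt.1 fun h => ?_)
  · exact ((gRatio_two_rpow_lt_iff hc hd).2 h).ne' hdv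
  · exact ((gRatio_two_rpow_lt_iff hd hc).2 h).ne hdv

/-- existence and uniqueness of c(Θ), and condition (D.2) is equivalent to
R < (3/4)·R_max(Θ) (Lemma 3). -/
theorem stmt_5 (α ρr ρd ρs ρ0 T : ℝ)
    (hα : 1 < α) (hρr : 0 < ρr) (hρd : 0 < ρd) (hρs : 0 < ρs) (hρ0 : 0 < ρ0) (hT : 1 < T)
    (hcond : 10 < min (T / 4) (min (1 / (3 * (ρ0 / ρr))) (3 * (ρd / ρr) / (2 * (ρ0 / ρr))))) :
    (∃! c : ℝ, 0 < c ∧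
      gfun c / Real.sqrt c = (1 + ρd / ρr) * Real.sqrt (Kmax ρr ρd ρ0 T * ρr / α)) ∧
    ∀ c : ℝ, 0 < c →
      gfun c / Real.sqrt c = (1 + ρd / ρr) * Real.sqrt (Kmax ρr ρd ρ0 T * ρr / α) →
      ∀ R : ℝ, 0 < R →
        (ρr > 3 * α / (4 * (1 + ρd / ρr) ^ 2 * R) * (gfun (4 * R / (3 * Kmax ρr ρd ρ0 T))) ^ 2 ↔
          R < (3/4) * (c * Kmax ρr ρd ρ0 T)) := by
  have hK : 0 < Kmax ρr ρd ρ0 T := by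
    unfold Kmax
    exact lt_min (by linarith) (lt_min (by positivity) (by positivity))
  have hα0 : 0 < α := by linarith
  set K := Kmax ρr ρd ρ0 T
  set B := 1 + ρd / ρr with hB
  have hB0 : 0 < B := by positivity
  refine ⟨existsUnique_gfun_div_sqrt_eq (by positivity), ?_⟩
  intro c hc hcv R hR
  rw [gfun_div_sqrt hc] at hcv
  set x := 4 * R / (3 * K) with hx
  have hx0 : 0 < x := by positivity
  have hRx : R = 3 / 4 * (x * K) := by rw [hx]; field_simp
  have hg : gfun x ^ 2 = x * gRatio (2 ^ x) ^ 2 := by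
    rw [← gfun_div_sqrt hx0, div_pow, Real.sq_sqrt hx0.le]
    field_simp
  have hlhs : 3 * α / (4 * B ^ 2 * R) * gfun x ^ 2 =
      α / (B ^ 2 * K) * gRatio (2 ^ x) ^ 2 := by
    rw [hg, hRx]
    field_simp
  have hrhs : ρr = α / (B ^ 2 * K) * gRatio (2 ^ c) ^ 2 := by
    rw [hcv, mul_pow, Real.sq_sqrt (by positivity)]
    field_simp
  calc ρr > 3 * α / (4 * B ^ 2 * R) * gfun x ^ 2
      ↔ α / (B ^ 2 * K) * gRatio (2 ^ x) ^ 2 < α / (B ^ 2 * K) * gRatio (2 ^ c) ^ 2 := by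
        rw [hlhs, ← hrhs]
    _ ↔ gRatio (2 ^ x) < gRatio (2 ^ c) := by
        rw [mul_lt_mul_iff_right₀ (by positivity),
          sq_lt_sq₀ (gRatio_pos (one_lt_two_rpow hx0)).le (gRatio_pos (one_lt_two_rpow hc)).le]
    _ ↔ x < c := gRatio_two_rpow_lt_iff hx0 hc
    _ ↔ R < 3 / 4 * (c * K) := by
        rw [hRx, mul_lt_mul_iff_right₀ (by norm_num), mul_lt_mul_iff_left₀ hK]
end

section
/- Fix R > 0, α > 1, T > 1 and β > 0, and for ρ_r > 0 let Θ(ρ_r) denote a parameter tuple with receiver parameter ρ_r and ρ_d = β·ρ_r. If 0 < ρ_{r1} < ρ_{r2}, then x'(R,Θ(ρ_{r1})) < x'(R,Θ(ρ_{r2})); i.e., x'(R,Θ) is strictly increasing in ρ_r (equivalently, strictly decreasing as ρ_r decreases) when the ratio ρ_d/ρ_r is held fixed. -/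
open Real

/-- The function `u ↦ u * exp u - exp u + 1` is positive on the positive reals. -/
lemma mul_exp_sub_exp_add_one_pos {u : ℝ} (hu : 0 < u) : 0 < u * exp u - exp u + 1 := by
  have h := add_one_lt_exp (x := -u) (by linarith)
  have h' : exp u * exp (-u) = 1 := by rw [← exp_add]; simp
  nlinarith [exp_pos u]

/-- The function `u ↦ u * exp u - exp u + 1` is strictly increasing on the nonnegative reals. -/
lemma mul_exp_sub_exp_add_one_lt {a b : ℝ} (ha : 0 ≤ a) (hab : a < b) :
    a * exp a - exp a + 1 < b * exp b - exp b + 1 := by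
  have h := add_one_lt_exp (x := a - b) (by linarith)
  have h' : exp b * exp (a - b) = exp a := by rw [← exp_add]; simp
  have h'' := exp_lt_exp.2 hab
  nlinarith [exp_pos b]

/-- Cross-multiplied form of the monotonicity of `u ↦ u * exp u / (exp u - 1)`. -/
lemma mul_exp_mul_exp_sub_one_le {a b : ℝ} (ha : 0 < a) (hab : a < b) :
    a * exp a * (exp b - 1) ≤ b * exp b * (exp a - 1) := by
  have hb : 0 < b := ha.trans hab
  have hc := convexOn_exp.2 (Set.mem_univ (-b)) (Set.mem_univ 0)
    (show 0 ≤ a / b by positivity)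
    (show 0 ≤ 1 - a / b by rw [sub_nonneg, div_le_one hb]; exact hab.le) (by ring)
  have hpt : a / b * -b + (1 - a / b) * 0 = -a := by field_simp; ring
  simp only [smul_eq_mul, hpt, exp_zero, mul_one] at hc
  have hc' : b * exp (-a) ≤ a * exp (-b) + (b - a) := by
    calc b * exp (-a) ≤ b * (a / b * exp (-b) + (1 - a / b)) := by gcongr
      _ = a * exp (-b) + (b - a) := by field_simp
  have hm := mul_le_mul_of_nonneg_left hc' (mul_pos (exp_pos a) (exp_pos b)).le
  have h1 : exp a * exp (-a) = 1 := by rw [← exp_add]; simp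
  have h2 : exp b * exp (-b) = 1 := by rw [← exp_add]; simp
  linear_combination hm - b * exp b * h1 + a * exp a * h2

lemma gfun_strictMonoOn : StrictMonoOn gfun (Set.Ioi 0) := by
  intro x hx y hy hxy
  rw [Set.mem_Ioi] at hx hy
  have hL : 0 < log 2 := log_pos (by norm_num)
  have ha : 0 < log 2 * x := mul_pos hL hx
  have hab : log 2 * x < log 2 * y := mul_lt_mul_of_pos_left hxy hL
  have hxpos := mul_exp_sub_exp_add_one_pos ha
  have hlt := mul_exp_sub_exp_add_one_lt ha.le hab
  have hle := mul_exp_mul_exp_sub_one_le ha hab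
  have hA : 0 < exp (log 2 * x) - 1 := by linarith [add_one_lt_exp ha.ne']
  have hB : 0 < exp (log 2 * y) - 1 := by linarith [add_one_lt_exp (ha.trans hab).ne']
  have hg (z : ℝ) : gfun z = sqrt (z / (exp (log 2 * z) - 1)) *
      (log 2 * z * exp (log 2 * z) - exp (log 2 * z) + 1) := by
    rw [gfun, rpow_def_of_pos (by norm_num : (0 : ℝ) < 2)]
    ring
  rw [hg, hg]
  generalize exp (log 2 * x) = A at *
  generalize exp (log 2 * y) = B at *
  set p := log 2 * x * A - A + 1 with hp
  set q := log 2 * y * B - B + 1 with hq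
  have hqpos : 0 < q := hxpos.trans hlt
  have hpq : p * (B - 1) ≤ q * (A - 1) := by linear_combination hle
  refine lt_of_pow_lt_pow_left₀ 2 (by positivity) ?_
  rw [mul_pow, mul_pow, sq_sqrt (by positivity), sq_sqrt (by positivity),
    div_mul_eq_mul_div, div_mul_eq_mul_div, div_lt_div_iff₀ hA hB]
  calc x * p ^ 2 * (B - 1) = x * p * (p * (B - 1)) := by ring
    _ ≤ x * p * (q * (A - 1)) := by gcongr
    _ < y * q * (q * (A - 1)) := by gcongr
    _ = y * q ^ 2 * (A - 1) := by ring

/-- x'(R,Θ) is strictly increasing in ρ_r when ρ_d/ρ_r = β is held fixed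
(Lemma 4). -/
theorem stmt_6 (R α T β ρr₁ ρr₂ x₁ x₂ : ℝ)
    (hR : 0 < R) (hα : 1 < α) (hT : 1 < T) (hβ : 0 < β)
    (hρr₁ : 0 < ρr₁) (h12 : ρr₁ < ρr₂)
    (hx₁ : 0 < x₁) (hgx₁ : gfun x₁ = (1 + β) * Real.sqrt (R * ρr₁ / α))
    (hx₂ : 0 < x₂) (hgx₂ : gfun x₂ = (1 + β) * Real.sqrt (R * ρr₂ / α)) :
    x₁ < x₂ := by
  rw [← gfun_strictMonoOn.lt_iff_lt hx₁ hx₂, hgx₁, hgx₂]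
  gcongr
end

section
/- Let Θ = (α, ρ_r, ρ_d, ρ_s, ρ_0, T) be a parameter tuple satisfying min(T/4, 1/(3·ρ_0/ρ_r), 3·(ρ_d/ρ_r)/(2·ρ_0/ρ_r)) > 10, with β := ρ_d/ρ_r, and let R > 0. Then: (i) R < R_max(Θ) if and only if R/x'(R,Θ) < K_max(Θ), equivalently K'_csi(R,Θ) < K_max(Θ); and (ii) ρ_r < (α/(1+β)²)·g(R)²/R if and only if K'_csi(R,Θ) > 1, where K'_csi(R,Θ) := max( min( R/x'(R,Θ), K_max(Θ) ), 1 ). -/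
open Real

lemma exp_mul_sub_exp_add_one_pos {y : ℝ} (hy : 0 < y) : 0 < exp y * y - exp y + 1 := by
  have h1 : -y + 1 < exp (-y) := Real.add_one_lt_exp (by linarith)
  have h2 := mul_lt_mul_of_pos_left h1 (Real.exp_pos y)
  rw [← Real.exp_add, add_neg_cancel, Real.exp_zero] at h2
  linarith

/-- The auxiliary function `(y eʸ - eʸ + 1)² / (eʸ - 1)` is strictly increasing on `(0, ∞)`. -/
lemma exp_quotient_strictMonoOn :
    StrictMonoOn (fun y : ℝ => (exp y * y - exp y + 1) ^ 2 / (exp y - 1)) (Set.Ioi 0) := by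
  have hder : ∀ y : ℝ, 0 < y → HasDerivAt
      (fun y : ℝ => (exp y * y - exp y + 1) ^ 2 / (exp y - 1))
      ((2 * (exp y * y - exp y + 1) * (exp y * y) * (exp y - 1)
        - (exp y * y - exp y + 1) ^ 2 * exp y) / (exp y - 1) ^ 2) y := by
    intro y hy
    have hD : exp y - 1 ≠ 0 := by
      have := Real.add_one_lt_exp hy.ne'
      linarith
    have hE := Real.hasDerivAt_exp y
    have hN := ((((hE.mul (hasDerivAt_id y)).sub hE).add_const 1).pow 2).div (hE.sub_const 1) hD
    refine hN.congr_deriv ?_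
    simp
  refine strictMonoOn_of_deriv_pos (convex_Ioi 0)
    (fun y hy => (hder y hy).continuousAt.continuousWithinAt) ?_
  intro y hy
  rw [interior_Ioi] at hy
  have hy : 0 < y := hy
  rw [(hder y hy).deriv]
  have hD : y + 1 < exp y := Real.add_one_lt_exp hy.ne'
  have hN : 0 < exp y * y - exp y + 1 := exp_mul_sub_exp_add_one_pos hy
  have hE := Real.exp_pos y
  have hD' : 0 < exp y - 1 := by linarith
  have hkey : 0 < y * (exp y - 1) + (exp y - 1 - y) := by
    have := mul_pos hy hD'
    linarith
  have : 2 * (exp y * y - exp y + 1) * (exp y * y) * (exp y - 1)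
      - (exp y * y - exp y + 1) ^ 2 * exp y =
      (exp y * y - exp y + 1) * exp y * (y * (exp y - 1) + (exp y - 1 - y)) := by ring
  rw [this]
  positivity

lemma gfun_pos {x : ℝ} (hx : 0 < x) : 0 < gfun x := by
  have hl : 0 < Real.log 2 := Real.log_pos one_lt_two
  have h2 : (2 : ℝ) ^ x = exp (Real.log 2 * x) := Real.rpow_def_of_pos two_pos x
  have hy : 0 < Real.log 2 * x := mul_pos hl hx
  have hN := exp_mul_sub_exp_add_one_pos hy
  have hD := Real.add_one_lt_exp hy.ne'
  unfold gfun
  rw [h2]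
  refine mul_pos (Real.sqrt_pos.2 (div_pos hx (by linarith))) ?_
  linarith

lemma gfun_sq {x : ℝ} (hx : 0 < x) :
    gfun x ^ 2 = x * ((exp (Real.log 2 * x) * (Real.log 2 * x) - exp (Real.log 2 * x) + 1) ^ 2
      / (exp (Real.log 2 * x) - 1)) := by
  have hl : 0 < Real.log 2 := Real.log_pos one_lt_two
  have h2 : (2 : ℝ) ^ x = exp (Real.log 2 * x) := Real.rpow_def_of_pos two_pos x
  have hy : 0 < Real.log 2 * x := mul_pos hl hx
  have hD := Real.add_one_lt_exp hy.ne'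
  unfold gfun
  rw [h2, mul_pow, Real.sq_sqrt (div_nonneg hx.le (by linarith))]
  ring

lemma gfun_sq_div_strictMonoOn : StrictMonoOn (fun x => gfun x ^ 2 / x) (Set.Ioi 0) := by
  intro a ha b hb hab
  have ha : 0 < a := ha
  have hb : 0 < b := hb
  have hl : 0 < Real.log 2 := Real.log_pos one_lt_two
  simp only [gfun_sq ha, gfun_sq hb, mul_div_cancel_left₀ _ ha.ne', mul_div_cancel_left₀ _ hb.ne']
  exact exp_quotient_strictMonoOn (Set.mem_Ioi.2 (mul_pos hl ha)) (Set.mem_Ioi.2 (mul_pos hl hb))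
    (mul_lt_mul_of_pos_left hab hl)

lemma gfun_sq_strictMonoOn : StrictMonoOn (fun x => gfun x ^ 2) (Set.Ioi 0) := by
  intro a ha b hb hab
  have h := gfun_sq_div_strictMonoOn ha hb hab
  have ha : 0 < a := ha
  have hb : 0 < b := hb
  have h1 : 0 < gfun a ^ 2 / a := div_pos (pow_pos (gfun_pos ha) 2) ha
  have := mul_lt_mul'' hab h ha.le h1.le
  simpa only [mul_div_cancel₀ _ ha.ne', mul_div_cancel₀ _ hb.ne'] using this

/-- characterizations of K'_csi(R,Θ) lying strictly between 1 and K_max(Θ)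
(Lemma 5). -/
theorem stmt_10 (α ρr ρd ρs ρ0 T R x' c K' : ℝ)
    (hα : 1 < α) (hρr : 0 < ρr) (hρd : 0 < ρd) (hρs : 0 < ρs) (hρ0 : 0 < ρ0) (hT : 1 < T)
    (hcond : 10 < min (T / 4) (min (1 / (3 * (ρ0 / ρr))) (3 * (ρd / ρr) / (2 * (ρ0 / ρr)))))
    (hR : 0 < R)
    (hx' : 0 < x') (hgx' : gfun x' = (1 + ρd / ρr) * Real.sqrt (R * ρr / α))
    (hc : 0 < c)
    (hgc : gfun c / Real.sqrt c = (1 + ρd / ρr) * Real.sqrt (Kmax ρr ρd ρ0 T * ρr / α))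
    (hK' : K' = max (min (R / x') (Kmax ρr ρd ρ0 T)) 1) :
    (R < c * Kmax ρr ρd ρ0 T ↔ R / x' < Kmax ρr ρd ρ0 T) ∧
      (R < c * Kmax ρr ρd ρ0 T ↔ K' < Kmax ρr ρd ρ0 T) ∧
      (ρr < α / (1 + ρd / ρr) ^ 2 * (gfun R) ^ 2 / R ↔ 1 < K') := by
  have hα0 : 0 < α := by linarith
  set K := Kmax ρr ρd ρ0 T with hKdef
  have hK : 10 < K := by
    have e1 : 1 / (3 * (ρ0 / ρr)) = ρr / (3 * ρ0) := by field_simp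
    have e2 : 3 * (ρd / ρr) / (2 * (ρ0 / ρr)) = 3 * ρd / (2 * ρ0) := by field_simp
    rw [e1, e2] at hcond
    exact hcond
  have hK0 : 0 < K := by linarith
  have hB : 0 < 1 + ρd / ρr := by positivity
  set B := 1 + ρd / ρr
  have hx2 : gfun x' ^ 2 = B ^ 2 * (R * ρr / α) := by
    rw [hgx', mul_pow, Real.sq_sqrt (by positivity)]
  have hx3 : gfun x' ^ 2 / x' = B ^ 2 * ρr / α * (R / x') := by
    rw [hx2]
    field_simp
  have hc2 : gfun c ^ 2 / c = B ^ 2 * ρr / α * K := by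
    have h := congrArg (fun t => t ^ 2) hgc
    simp only [div_pow, mul_pow] at h
    rw [Real.sq_sqrt hc.le, Real.sq_sqrt (by positivity)] at h
    rw [h]
    ring
  have hC : 0 < B ^ 2 * ρr / α := by positivity
  have hcmp : x' < c ↔ R / x' < K := by
    rw [← gfun_sq_div_strictMonoOn.lt_iff_lt (Set.mem_Ioi.2 hx') (Set.mem_Ioi.2 hc)]
    simp only [hx3, hc2]
    exact mul_lt_mul_iff_right₀ hC
  have hmain : R < c * K ↔ R / x' < K := by
    constructor
    · intro h
      by_contra hn
      have hcx : c ≤ x' := not_lt.1 (fun hlt => hn (hcmp.1 hlt))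
      have hKR : K * x' ≤ R := (le_div_iff₀ hx').1 (not_lt.1 hn)
      nlinarith
    · intro h
      have hxc := hcmp.2 h
      have hRK : R < K * x' := (div_lt_iff₀ hx').1 h
      nlinarith
  refine ⟨hmain, ?_, ?_⟩
  · rw [hmain, hK', max_lt_iff, min_lt_iff]
    constructor
    · exact fun h => ⟨Or.inl h, by linarith⟩
    · rintro ⟨h | h, -⟩
      · exact h
      · exact absurd h (lt_irrefl _)
  · have hright : 1 < K' ↔ x' < R := by
      rw [hK', lt_max_iff, lt_min_iff, one_lt_div hx']
      constructor
      · rintro (h | h)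
        · exact h.1
        · exact absurd h (lt_irrefl _)
      · exact fun h => Or.inl ⟨h, by linarith⟩
    rw [hright, ← gfun_sq_strictMonoOn.lt_iff_lt (Set.mem_Ioi.2 hx') (Set.mem_Ioi.2 hR)]
    simp only [hx2]
    have e : α / B ^ 2 * gfun R ^ 2 / R = gfun R ^ 2 / (B ^ 2 * R / α) := by field_simp
    rw [e, lt_div_iff₀ (by positivity)]
    have e' : ρr * (B ^ 2 * R / α) = B ^ 2 * (R * ρr / α) := by ring
    rw [e']
end

section
/- Let Θ = (α, ρ_r, ρ_d, ρ_s, ρ_0, T) be a parameter tuple satisfying min(T/4, 1/(3·ρ_0/ρ_r), 3·(ρ_d/ρ_r)/(2·ρ_0/ρ_r)) > 10, and let R > 0. Then ζ'_zf(R,Θ) < ζ'_csi(R,Θ). -/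
open Real

theorem div_sub_le_gammaU {M K τ R T : ℝ} (hR : 0 < R) (hK : 0 < K) (hτ : 0 < τ) (hτT : τ < T)
    (hKM : K < M) : ((2:ℝ) ^ (R / K) - 1) / (M - K) ≤ gammaU M K τ R T := by
  have hT : 0 < T := hτ.trans hτT
  have hd : 0 < 1 - τ / T := by
    rw [sub_pos, div_lt_one hT]
    exact hτT
  have hd1 : 1 - τ / T ≤ 1 := by
    have : 0 < τ / T := div_pos hτ hT
    linarith
  have hMK : 0 < M - K := sub_pos.2 hKM
  have hexp : R / K ≤ R / (K * (1 - τ / T)) :=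
    div_le_div_of_nonneg_left hR.le (mul_pos hK hd) (mul_le_of_le_one_right hK.le hd1)
  have hpow : (2:ℝ) ^ (R / K) ≤ (2:ℝ) ^ (R / (K * (1 - τ / T))) :=
    Real.rpow_le_rpow_of_exponent_le one_le_two hexp
  have hone : (1:ℝ) ≤ (2:ℝ) ^ (R / K) :=
    Real.one_le_rpow one_le_two (div_pos hR hK).le
  unfold gammaU
  set E := (2:ℝ) ^ (R / (K * (1 - τ / T))) - 1 with hE
  have hE0 : 0 ≤ E := by linarith
  set a := (K + τ) * E / (2 * τ * (M - K)) with ha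
  have ha0 : 0 ≤ a := by positivity
  have hsqrt : a ≤ √(a ^ 2 + E / (τ * (M - K))) := by
    apply Real.le_sqrt_of_sq_le
    have : 0 ≤ E / (τ * (M - K)) := by positivity
    linarith
  have h2a : 2 * a = E / (M - K) + K * E / (τ * (M - K)) := by
    rw [ha]
    field_simp
    ring
  have hrest : 0 ≤ K * E / (τ * (M - K)) := by positivity
  have hle : ((2:ℝ) ^ (R / K) - 1) / (M - K) ≤ E / (M - K) := by
    gcongr
    linarith
  linarith

theorem Pcsi_add_le_Ptot {M K τ R α ρr ρd ρs ρ0 T : ℝ} (hR : 0 < R) (hα : 0 < α) (hρ0 : 0 < ρ0)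
    (hK : 1 ≤ K) (hτ : 0 < τ) (hτT : τ < T) (hKM : K < M) :
    Pcsi M K R α ρr ρd ρs + 2 * ρ0 ≤ Ptot M K τ R α ρr ρd ρs ρ0 T := by
  have hK0 : 0 < K := by linarith
  have hM0 : 0 < M := hK0.trans hKM
  have hT : 0 < T := hτ.trans hτT
  have hγ := mul_le_mul_of_nonneg_left (div_sub_le_gammaU hR hK0 hτ hτT hKM) (mul_pos hα hK0).le
  have h1 : 0 ≤ K * ((8/3) * K ^ 2 * ρ0 / T) := by positivity
  have h2 : 0 ≤ M * (4 * K ^ 2 * ρ0 / T) := by positivity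
  have hMK : 1 ≤ M * K := one_le_mul_of_one_le_of_one_le (hK.trans hKM.le) hK
  have h3 : ρ0 ≤ M * K * ρ0 := le_mul_of_one_le_left hρ0.le hMK
  unfold Pcsi Ptot
  rw [mul_div_assoc]
  linarith

theorem le_Pcsi {M K R α ρr ρd ρs : ℝ} (hR : 0 < R) (hα : 0 < α) (hρr : 0 < ρr) (hρd : 0 < ρd)
    (hK : 0 < K) (hKM : K < M) : ρs ≤ Pcsi M K R α ρr ρd ρs := by
  have hM0 : 0 < M := hK.trans hKM
  have hMK : 0 < M - K := sub_pos.2 hKM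
  have hone : 0 ≤ (2:ℝ) ^ (R / K) - 1 :=
    sub_nonneg.2 (Real.one_le_rpow one_le_two (div_pos hR hK).le)
  have : 0 ≤ α * K * ((2:ℝ) ^ (R / K) - 1) / (M - K) + M * ρr + K * ρd := by positivity
  exact le_add_of_nonneg_left this

/-- upper bound ζ'_zf(R,Θ) < ζ'_csi(R,Θ) (Lemma 8). -/
theorem stmt_13 (α ρr ρd ρs ρ0 T R : ℝ)
    (hα : 1 < α) (hρr : 0 < ρr) (hρd : 0 < ρd) (hρs : 0 < ρs) (hρ0 : 0 < ρ0) (hT : 1 < T)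
    (hcond : 10 < min (T / 4)
      (min (1 / (3 * (ρ0 / ρr))) (3 * (ρd / ρr) / (2 * (ρ0 / ρr)))))
    (hR : 0 < R) :
    zetaZfPrime R α ρr ρd ρs ρ0 T < zetaCsiPrime R α ρr ρd ρs ρ0 T := by
  have hα0 : 0 < α := by linarith
  have hKmax : 1 ≤ Kmax ρr ρd ρ0 T := by
    have h1 : 1 / (3 * (ρ0 / ρr)) = ρr / (3 * ρ0) := by field_simp
    have h2 : 3 * (ρd / ρr) / (2 * (ρ0 / ρr)) = 3 * ρd / (2 * ρ0) := by field_simp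
    rw [h1, h2] at hcond
    unfold Kmax
    linarith
  unfold zetaZfPrime zetaCsiPrime
  set A := {p : ℝ | ∃ M K τ : ℝ, 1 ≤ K ∧ K ≤ Kmax ρr ρd ρ0 T ∧ K ≤ τ ∧ τ < T ∧ K < M ∧
    p = Ptot M K τ R α ρr ρd ρs ρ0 T}
  set B := {p : ℝ | ∃ M K : ℝ, 1 ≤ K ∧ K ≤ Kmax ρr ρd ρ0 T ∧ K < M ∧
    p = Pcsi M K R α ρr ρd ρs}
  have hA : A.Nonempty := ⟨_, 2, 1, 1, le_rfl, hKmax, le_rfl, hT, one_lt_two, rfl⟩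
  have hB : B.Nonempty := ⟨_, 2, 1, le_rfl, hKmax, one_lt_two, rfl⟩
  have hBlow : ∀ p ∈ B, ρs ≤ p := by
    rintro p ⟨M, K, hK, -, hKM, rfl⟩
    exact le_Pcsi hR hα0 hρr hρd (by linarith) hKM
  have hBpos : 0 < sInf B := hρs.trans_le (le_csInf hB hBlow)
  have hBA : sInf B + 2 * ρ0 ≤ sInf A := by
    refine le_csInf hA ?_
    rintro p ⟨M, K, τ, hK, hKm, hKτ, hτT, hKM, rfl⟩
    have hmem : sInf B ≤ Pcsi M K R α ρr ρd ρs :=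
      csInf_le ⟨ρs, hBlow⟩ ⟨M, K, hK, hKm, hKM, rfl⟩
    have := Pcsi_add_le_Ptot (ρr := ρr) (ρd := ρd) (ρs := ρs) hR hα0 hρ0 hK
      (show 0 < τ by linarith) hτT hKM
    linarith
  exact div_lt_div_of_pos_left hR hBpos (by linarith)
end
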